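/- arXiv:1807.04137 — 3 statements merged into one kernel-verified Lean document; each statement's English description precedes it below -/
import Mathlib

section
/- Fix N ≥ 1 and k ≥ 0. The dual increment spaces satisfy dim W^k_{0,N,D} = 2(k+1) and dim W^k_{l,N,D} = 2^{l−1}(k+1) for 1 ≤ l ≤ N; in particular, the restriction map taking the multiwavelet space W_l^k([−h_N/2, 1−h_N/2]) to functions on [0,1] is injective for every 1 ≤ l ≤ N. -/
open scoped BigOperators
open MeasureTheory

def PPoly (a b : ℝ) (n k : ℕ) (f : ℝ → ℝ) : Prop :=
  (∀ j : ℕ, j < 2 ^ n →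
    ∃ p : Polynomial ℝ, p.natDegree ≤ k ∧
      ∀ x ∈ Set.Ico (a + j * ((b - a) / 2 ^ n)) (a + (j + 1) * ((b - a) / 2 ^ n)),
        f x = p.eval x) ∧
  ∀ x, x ∉ Set.Ico a b → f x = 0

noncomputable def Vsp (a b : ℝ) (n k : ℕ) : Submodule ℝ (ℝ → ℝ) :=
  Submodule.span ℝ {f | PPoly a b n k f}

noncomputable def L2ip (a b : ℝ) (f g : ℝ → ℝ) : ℝ := ∫ x in Set.Ico a b, f x * g x

noncomputable def Wsp (a b : ℝ) (n k : ℕ) : Submodule ℝ (ℝ → ℝ) :=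
  if n = 0 then Vsp a b 0 k
  else Submodule.span ℝ
    {f | f ∈ Vsp a b n k ∧ ∀ g ∈ Vsp a b (n - 1) k, L2ip a b f g = 0}

noncomputable def dualLeft (N l j : ℕ) : ℝ :=
  if j = 0 then 0 else (j : ℝ) / 2 ^ l - 1 / 2 ^ (N + 1)

noncomputable def dualRight (N l j : ℕ) : ℝ :=
  if j = 2 ^ l then 1 else ((j : ℝ) + 1) / 2 ^ l - 1 / 2 ^ (N + 1)

def dualPPoly (N l k : ℕ) (f : ℝ → ℝ) : Prop :=
  (∀ j : ℕ, j ≤ 2 ^ l →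
    ∃ p : Polynomial ℝ, p.natDegree ≤ k ∧
      ∀ x ∈ Set.Ico (dualLeft N l j) (dualRight N l j), f x = p.eval x) ∧
  ∀ x, x ∉ Set.Ico (0 : ℝ) 1 → f x = 0

noncomputable def Vd (N l k : ℕ) : Submodule ℝ (ℝ → ℝ) :=
  Submodule.span ℝ {f | dualPPoly N l k f}

/-- The restriction map to `[0,1]` (functions are extended by zero outside `[0,1)`). -/
noncomputable def restr01 : (ℝ → ℝ) →ₗ[ℝ] (ℝ → ℝ) where
  toFun f := (Set.Ico (0 : ℝ) 1).indicator f
  map_add' f g := by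
    funext x
    by_cases h : x ∈ Set.Ico (0 : ℝ) 1 <;> simp [Set.indicator, h]
  map_smul' c f := by
    funext x
    by_cases h : x ∈ Set.Ico (0 : ℝ) 1 <;> simp [Set.indicator, h]

/-- The dual increment space `W^k_{l,N,D}`: `V^k_{0,N,D}` for `l = 0`, and the restriction to
`[0,1]` of the multiwavelet space `W_l^k([-h_N/2, 1-h_N/2])` for `l ≥ 1`. -/
noncomputable def Wd (N l k : ℕ) : Submodule ℝ (ℝ → ℝ) :=
  if l = 0 then Vd N 0 k
  else Submodule.map restr01 (Wsp (-(1 / 2 ^ (N + 1))) (1 - 1 / 2 ^ (N + 1)) l k)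

/-- Piecewise polynomials of degree at most `k` on the cells `[t j, t (j + 1))`, `j < m`,
extended by zero. -/
def piecewisePoly (t : ℕ → ℝ) (m k : ℕ) : Submodule ℝ (ℝ → ℝ) where
  carrier := {f | (∀ j : ℕ, j < m → ∃ p : Polynomial ℝ, p.natDegree ≤ k ∧
      ∀ x ∈ Set.Ico (t j) (t (j + 1)), f x = p.eval x) ∧ ∀ x, x ∉ Set.Ico (t 0) (t m) → f x = 0}
  add_mem' := by
    rintro f g ⟨hf, hf'⟩ ⟨hg, hg'⟩
    refine ⟨fun j hj => ?_, fun x hx => by simp [hf' x hx, hg' x hx]⟩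
    obtain ⟨p, hp, hfp⟩ := hf j hj
    obtain ⟨q, hq, hgq⟩ := hg j hj
    exact ⟨p + q, (Polynomial.natDegree_add_le p q).trans (max_le hp hq),
      fun x hx => by simp [hfp x hx, hgq x hx]⟩
  zero_mem' := ⟨fun _ _ => ⟨0, by simp⟩, fun _ _ => rfl⟩
  smul_mem' := by
    rintro c f ⟨hf, hf'⟩
    refine ⟨fun j hj => ?_, fun x hx => by simp [hf' x hx]⟩
    obtain ⟨p, hp, hfp⟩ := hf j hj
    exact ⟨c • p, (Polynomial.natDegree_smul_le c p).trans hp,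
      fun x hx => by simp [hfp x hx]⟩

lemma mem_piecewisePoly {t : ℕ → ℝ} {m k : ℕ} {f : ℝ → ℝ} :
    f ∈ piecewisePoly t m k ↔ (∀ j : ℕ, j < m → ∃ p : Polynomial ℝ, p.natDegree ≤ k ∧
      ∀ x ∈ Set.Ico (t j) (t (j + 1)), f x = p.eval x) ∧
      ∀ x, x ∉ Set.Ico (t 0) (t m) → f x = 0 := Iff.rfl

lemma mul_mem_piecewisePoly {t : ℕ → ℝ} {m k l : ℕ} {f g : ℝ → ℝ}
    (hf : f ∈ piecewisePoly t m k) (hg : g ∈ piecewisePoly t m l) :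
    (fun x => f x * g x) ∈ piecewisePoly t m (k + l) := by
  refine ⟨fun j hj => ?_, fun x hx => by simp [hf.2 x hx]⟩
  obtain ⟨p, hp, hfp⟩ := hf.1 j hj
  obtain ⟨q, hq, hgq⟩ := hg.1 j hj
  exact ⟨p * q, Polynomial.natDegree_mul_le.trans (add_le_add hp hq),
    fun x hx => by simp [hfp x hx, hgq x hx]⟩

lemma exists_mem_Ico_succ (t : ℕ → ℝ) {m : ℕ} {x : ℝ} (hx : x ∈ Set.Ico (t 0) (t m)) :
    ∃ j < m, x ∈ Set.Ico (t j) (t (j + 1)) := by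
  induction m with
  | zero => exact absurd (hx.1.trans_lt hx.2) (lt_irrefl _)
  | succ m ih =>
    rcases lt_or_ge x (t m) with h | h
    · obtain ⟨j, hj, hxj⟩ := ih ⟨hx.1, h⟩
      exact ⟨j, hj.trans (Nat.lt_succ_self m), hxj⟩
    · exact ⟨m, Nat.lt_succ_self m, h, hx.2⟩

/-- Glue one polynomial per cell into a piecewise polynomial. -/
noncomputable def gluePoly (t : ℕ → ℝ) (m k : ℕ) :
    (Fin m → Polynomial.degreeLT ℝ (k + 1)) →ₗ[ℝ] (ℝ → ℝ) where
  toFun p x := ∑ j : Fin m,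
    (Set.Ico (t j) (t (j + 1))).indicator (fun y => (p j : Polynomial ℝ).eval y) x
  map_add' p q := by
    funext x
    simp [Set.indicator, ← Finset.sum_add_distrib, ite_add_ite]
  map_smul' c p := by
    funext x
    simp [Set.indicator, Finset.mul_sum]

lemma gluePoly_apply_of_mem {t : ℕ → ℝ} (ht : StrictMono t) {m k : ℕ}
    (p : Fin m → Polynomial.degreeLT ℝ (k + 1)) (j : Fin m) {x : ℝ}
    (hx : x ∈ Set.Ico (t j) (t (j + 1))) :
    gluePoly t m k p x = (p j : Polynomial ℝ).eval x := by
  change ∑ i : Fin m, _ = _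
  rw [Finset.sum_eq_single j]
  · simp [Set.indicator_of_mem hx]
  · intro i _ hij
    refine Set.indicator_of_notMem (fun hi => ?_) _
    exact Set.disjoint_left.1 (ht.monotone.pairwise_disjoint_on_Ico_succ
      (fun h => hij (Fin.ext h))) hi hx
  · simp

lemma gluePoly_apply_of_notMem {t : ℕ → ℝ} (ht : Monotone t) {m k : ℕ}
    (p : Fin m → Polynomial.degreeLT ℝ (k + 1)) {x : ℝ} (hx : x ∉ Set.Ico (t 0) (t m)) :
    gluePoly t m k p x = 0 := by
  change ∑ j : Fin m, _ = (0 : ℝ)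
  refine Finset.sum_eq_zero fun j _ => Set.indicator_of_notMem (fun hj => hx ?_) _
  exact ⟨(ht (Nat.zero_le _)).trans hj.1, hj.2.trans_le (ht j.2)⟩

lemma mem_degreeLT_succ_iff {k : ℕ} {p : Polynomial ℝ} :
    p ∈ Polynomial.degreeLT ℝ (k + 1) ↔ p.natDegree ≤ k := by
  rw [Polynomial.degreeLT_succ_eq_degreeLE, Polynomial.mem_degreeLE,
    Polynomial.natDegree_le_iff_degree_le]

lemma range_gluePoly {t : ℕ → ℝ} (ht : StrictMono t) (m k : ℕ) :
    LinearMap.range (gluePoly t m k) = piecewisePoly t m k := by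
  ext f
  constructor
  · rintro ⟨p, rfl⟩
    refine ⟨fun j hj => ⟨p ⟨j, hj⟩, mem_degreeLT_succ_iff.1 (p ⟨j, hj⟩).2,
      fun x hx => gluePoly_apply_of_mem ht p ⟨j, hj⟩ hx⟩, fun x hx =>
      gluePoly_apply_of_notMem ht.monotone p hx⟩
  · rintro ⟨hf, hf'⟩
    choose p hp hfp using hf
    have hmem : gluePoly t m k (fun j => ⟨p j j.2, mem_degreeLT_succ_iff.2 (hp j j.2)⟩) = f := by
      funext x
      by_cases hx : x ∈ Set.Ico (t 0) (t m)
      · obtain ⟨j, hj, hxj⟩ := exists_mem_Ico_succ t hx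
        rw [gluePoly_apply_of_mem ht _ ⟨j, hj⟩ hxj, hfp j hj x hxj]
      · rw [hf' x hx, gluePoly_apply_of_notMem ht.monotone _ hx]
    exact ⟨_, hmem⟩

lemma gluePoly_injective {t : ℕ → ℝ} (ht : StrictMono t) (m k : ℕ) :
    Function.Injective (gluePoly t m k) := by
  rw [injective_iff_map_eq_zero]
  intro p hp
  funext j
  refine Subtype.ext (Polynomial.eq_zero_of_infinite_isRoot _ ?_)
  refine (Set.Ico_infinite (ht (Nat.lt_succ_self j))).mono fun x hx => ?_
  change (p j : Polynomial ℝ).eval x = 0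
  rw [← gluePoly_apply_of_mem ht p j hx, hp]
  rfl

lemma finite_piecewisePoly {t : ℕ → ℝ} (ht : StrictMono t) (m k : ℕ) :
    Module.Finite ℝ (piecewisePoly t m k) := by
  have : Module.Finite ℝ (Polynomial.degreeLT ℝ (k + 1)) :=
    Module.Finite.equiv (Polynomial.degreeLTEquiv ℝ (k + 1)).symm
  rw [← range_gluePoly ht]
  infer_instance

lemma finrank_piecewisePoly {t : ℕ → ℝ} (ht : StrictMono t) (m k : ℕ) :
    Module.finrank ℝ (piecewisePoly t m k) = m * (k + 1) := by
  have : Module.Finite ℝ (Polynomial.degreeLT ℝ (k + 1)) :=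
    Module.Finite.equiv (Polynomial.degreeLTEquiv ℝ (k + 1)).symm
  rw [← range_gluePoly ht, LinearMap.finrank_range_of_inj (gluePoly_injective ht m k),
    Module.finrank_pi_fintype]
  simp [(Polynomial.degreeLTEquiv ℝ (k + 1)).finrank_eq]

lemma integrable_of_mem_piecewisePoly {t : ℕ → ℝ} (ht : StrictMono t) {m k : ℕ} {f : ℝ → ℝ}
    (hf : f ∈ piecewisePoly t m k) : Integrable f := by
  rw [← range_gluePoly ht] at hf
  obtain ⟨p, rfl⟩ := hf
  change Integrable (fun x => ∑ j : Fin m,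
    (Set.Ico (t j) (t (j + 1))).indicator (fun y => (p j : Polynomial ℝ).eval y) x)
  refine integrable_finsetSum Finset.univ fun j _ => ?_
  rw [integrable_indicator_iff measurableSet_Ico]
  exact ((Polynomial.continuous _).integrableOn_Icc).mono_set Set.Ico_subset_Icc_self

lemma eq_zero_of_mem_piecewisePoly_of_ae {t : ℕ → ℝ} (ht : StrictMono t) {m k : ℕ} {f : ℝ → ℝ}
    (hf : f ∈ piecewisePoly t m k) (h0 : ∀ᵐ x, f x = 0) : f = 0 := by
  funext x
  by_cases hx : x ∈ Set.Ico (t 0) (t m)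
  · obtain ⟨j, hj, hxj⟩ := exists_mem_Ico_succ t hx
    obtain ⟨p, -, hfp⟩ := hf.1 j hj
    have hinf : {x | p.IsRoot x}.Infinite := by
      intro hfin
      have hp : ∀ᵐ x, ¬ p.IsRoot x := by
        rw [ae_iff]
        simpa using hfin.measure_zero volume
      have hnull : volume (Set.Ico (t j) (t (j + 1))) = 0 := by
        refine measure_mono_null (fun y hy => ?_) (ae_iff.1 (h0.and hp))
        rintro ⟨h1, h2⟩
        exact h2 ((hfp y hy).symm.trans h1)
      rw [Real.volume_Ico, ENNReal.ofReal_eq_zero] at hnull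
      linarith [ht (Nat.lt_succ_self j)]
    rw [hfp x hxj, Polynomial.eq_zero_of_infinite_isRoot p hinf]
    simp
  · exact hf.2 x hx

/-- The `L²` inner product on piecewise polynomials. -/
noncomputable def piecewisePolyForm {t : ℕ → ℝ} (ht : StrictMono t) (m k : ℕ) (a b : ℝ) :
    LinearMap.BilinForm ℝ (piecewisePoly t m k) :=
  have hint (f g : piecewisePoly t m k) : IntegrableOn (fun x => f.1 x * g.1 x) (Set.Ico a b) :=
    (integrable_of_mem_piecewisePoly ht (mul_mem_piecewisePoly f.2 g.2)).integrableOn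
  LinearMap.mk₂ ℝ (fun f g => L2ip a b f g)
    (fun f f' g => by
      simp only [L2ip, Submodule.coe_add, Pi.add_apply, add_mul]
      exact integral_add (hint f g) (hint f' g))
    (fun c f g => by
      simp only [L2ip, Submodule.coe_smul, Pi.smul_apply, smul_eq_mul, mul_assoc]
      exact integral_const_mul c _)
    (fun f g g' => by
      simp only [L2ip, Submodule.coe_add, Pi.add_apply, mul_add]
      exact integral_add (hint f g) (hint f g'))
    (fun c f g => by
      simp only [L2ip, Submodule.coe_smul, Pi.smul_apply, smul_eq_mul, mul_left_comm _ c]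
      exact integral_const_mul c _)

lemma piecewisePolyForm_apply {t : ℕ → ℝ} (ht : StrictMono t) (m k : ℕ) (a b : ℝ)
    (f g : piecewisePoly t m k) : piecewisePolyForm ht m k a b f g = L2ip a b f g := rfl

lemma L2ip_comm (a b : ℝ) (f g : ℝ → ℝ) : L2ip a b f g = L2ip a b g f := by
  simp only [L2ip, mul_comm]

lemma eq_zero_of_L2ip_self {t : ℕ → ℝ} (ht : StrictMono t) {m k : ℕ} {f : ℝ → ℝ}
    (hf : f ∈ piecewisePoly t m k) (h : L2ip (t 0) (t m) f f = 0) : f = 0 := by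
  refine eq_zero_of_mem_piecewisePoly_of_ae ht hf ?_
  have h1 : ∫ x, f x * f x = 0 := by
    rw [← h, L2ip, setIntegral_eq_integral_of_forall_compl_eq_zero]
    intro x hx
    simp [hf.2 x hx]
  rw [integral_eq_zero_iff_of_nonneg (fun x => mul_self_nonneg (f x))
    (integrable_of_mem_piecewisePoly ht (mul_mem_piecewisePoly hf hf))] at h1
  filter_upwards [h1] with x hx
  exact mul_self_eq_zero.1 hx

/-- Nodes of the uniform partition of `[a, b]` into `2 ^ n` cells. -/
noncomputable def uniformNode (a b : ℝ) (n j : ℕ) : ℝ := a + j * ((b - a) / 2 ^ n)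

lemma uniformNode_zero (a b : ℝ) (n : ℕ) : uniformNode a b n 0 = a := by simp [uniformNode]

lemma uniformNode_two_pow (a b : ℝ) (n : ℕ) : uniformNode a b n (2 ^ n) = b := by
  simp only [uniformNode]; push_cast; field_simp; ring

lemma uniformNode_succ_two_mul (a b : ℝ) (n j : ℕ) :
    uniformNode a b (n + 1) (2 * j) = uniformNode a b n j := by
  simp only [uniformNode]; push_cast; field_simp; ring

lemma uniformNode_strictMono {a b : ℝ} (hab : a < b) (n : ℕ) : StrictMono (uniformNode a b n) := by
  intro i j hij
  have h : (0 : ℝ) < (b - a) / 2 ^ n := div_pos (sub_pos.2 hab) (by positivity)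
  have h' : (i : ℝ) < j := by exact_mod_cast hij
  simp only [uniformNode]
  gcongr

lemma Vsp_eq_piecewisePoly (a b : ℝ) (n k : ℕ) :
    Vsp a b n k = piecewisePoly (uniformNode a b n) (2 ^ n) k := by
  have : {f | PPoly a b n k f} = (piecewisePoly (uniformNode a b n) (2 ^ n) k : Set (ℝ → ℝ)) := by
    ext f
    rw [SetLike.mem_coe, mem_piecewisePoly, uniformNode_zero, uniformNode_two_pow]
    simp [PPoly, uniformNode]
  rw [Vsp, this, Submodule.span_eq]

lemma Vsp_le_succ {a b : ℝ} (hab : a < b) (n k : ℕ) : Vsp a b n k ≤ Vsp a b (n + 1) k := by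
  rw [Vsp_eq_piecewisePoly, Vsp_eq_piecewisePoly]
  rintro f ⟨hf, hf'⟩
  refine ⟨fun j hj => ?_, fun x hx => hf' x ?_⟩
  · obtain ⟨p, hp, hfp⟩ := hf (j / 2) (by rw [pow_succ] at hj; omega)
    refine ⟨p, hp, fun x hx => hfp x ?_⟩
    have hmono := (uniformNode_strictMono hab (n + 1)).monotone
    rw [← uniformNode_succ_two_mul, ← uniformNode_succ_two_mul a b n (j / 2 + 1)]
    exact ⟨(hmono (by omega)).trans hx.1, hx.2.trans_le (hmono (by omega))⟩
  · rwa [uniformNode_zero, uniformNode_two_pow] at hx ⊢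

lemma Wsp_succ_eq_map_orthogonal {a b : ℝ} (hab : a < b) (n k : ℕ) :
    Wsp a b (n + 1) k = (LinearMap.BilinForm.orthogonal
      (piecewisePolyForm (uniformNode_strictMono hab (n + 1)) (2 ^ (n + 1)) k a b)
      ((Vsp a b n k).comap (Submodule.subtype _))).map (Submodule.subtype _) := by
  rw [Wsp, if_neg n.succ_ne_zero, Nat.add_sub_cancel]
  rw [← Submodule.span_eq (Submodule.map _ _)]
  congr 1
  ext f
  simp only [Set.mem_ofPred_eq, SetLike.mem_coe, Submodule.mem_map,
    LinearMap.BilinForm.mem_orthogonal_iff, Submodule.mem_comap, Submodule.subtype_apply]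
  constructor
  · rintro ⟨hf, h⟩
    rw [Vsp_eq_piecewisePoly] at hf
    refine ⟨⟨f, hf⟩, fun g hg => ?_, rfl⟩
    rw [piecewisePolyForm_apply, L2ip_comm]
    exact h g hg
  · rintro ⟨f, h, rfl⟩
    refine ⟨by rw [Vsp_eq_piecewisePoly]; exact f.2, fun g hg => ?_⟩
    have hg' := Vsp_le_succ hab n k hg
    rw [Vsp_eq_piecewisePoly] at hg'
    rw [L2ip_comm]
    exact h ⟨g, hg'⟩ hg

lemma Wsp_succ_le_Vsp {a b : ℝ} (hab : a < b) (n k : ℕ) :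
    Wsp a b (n + 1) k ≤ Vsp a b (n + 1) k := by
  rw [Wsp_succ_eq_map_orthogonal hab, Vsp_eq_piecewisePoly a b (n + 1)]
  exact Submodule.map_subtype_le _ _

lemma finrank_Vsp {a b : ℝ} (hab : a < b) (n k : ℕ) :
    Module.finrank ℝ (Vsp a b n k) = 2 ^ n * (k + 1) := by
  rw [Vsp_eq_piecewisePoly, finrank_piecewisePoly (uniformNode_strictMono hab n)]

lemma finrank_Wsp_succ {a b : ℝ} (hab : a < b) (n k : ℕ) :
    Module.finrank ℝ (Wsp a b (n + 1) k) = 2 ^ n * (k + 1) := by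
  have ht := uniformNode_strictMono hab (n + 1)
  have := finite_piecewisePoly ht (2 ^ (n + 1)) k
  rw [Wsp_succ_eq_map_orthogonal hab, Submodule.finrank_map_subtype_eq]
  have hself (f : piecewisePoly (uniformNode a b (n + 1)) (2 ^ (n + 1)) k)
      (h : piecewisePolyForm ht (2 ^ (n + 1)) k a b f f = 0) : f = 0 := by
    refine Subtype.ext (eq_zero_of_L2ip_self ht f.2 ?_)
    rwa [uniformNode_zero, uniformNode_two_pow]
  have hnd : (piecewisePolyForm ht (2 ^ (n + 1)) k a b).Nondegenerate :=
    ⟨fun f hf => hself f (hf f), fun f hf => hself f (hf f)⟩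
  rw [LinearMap.BilinForm.finrank_orthogonal hnd, finrank_piecewisePoly ht]
  have hle := Vsp_le_succ hab n k
  rw [Vsp_eq_piecewisePoly a b (n + 1)] at hle
  rw [(Submodule.comapSubtypeEquivOfLe hle).finrank_eq, finrank_Vsp hab]
  rw [pow_succ, ← Nat.sub_mul]
  congr 1
  omega

lemma eq_zero_of_mem_Vsp_of_eqOn_Ico {a b : ℝ} (hab : a < b) {c : ℝ} {n k : ℕ} {f : ℝ → ℝ}
    (hf : f ∈ Vsp a b n k) (hac : a ≤ c) (hc : c < a + (b - a) / 2 ^ n)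
    (h : ∀ x ∈ Set.Ico c b, f x = 0) : f = 0 := by
  have hcell : a + (b - a) / 2 ^ n ≤ b := by
    have : (b - a) / 2 ^ n ≤ b - a :=
      div_le_self (sub_pos.2 hab).le (one_le_pow₀ (by norm_num))
    linarith
  rw [Vsp_eq_piecewisePoly] at hf
  obtain ⟨p, -, hp⟩ := hf.1 0 (by positivity)
  simp only [uniformNode, Nat.cast_zero, zero_mul, add_zero, zero_add, Nat.cast_one,
    one_mul] at hp
  have hp0 : p = 0 := by
    refine Polynomial.eq_zero_of_infinite_isRoot _ ((Set.Ico_infinite hc).mono fun x hx => ?_)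
    exact (hp x ⟨hac.trans hx.1, hx.2⟩).symm.trans (h x ⟨hx.1, hx.2.trans_le hcell⟩)
  funext x
  rcases lt_or_ge x c with hx | hx
  · rcases lt_or_ge x a with hxa | hxa
    · exact hf.2 x (by rw [uniformNode_zero]; exact fun h => hxa.not_ge h.1)
    · rw [hp x ⟨hxa, hx.trans hc⟩, hp0]; simp
  · rcases lt_or_ge x b with hxb | hxb
    · exact h x ⟨hx, hxb⟩
    · exact hf.2 x (by rw [uniformNode_two_pow]; exact fun h => hxb.not_gt h.2)

lemma eq_zero_of_mem_Vsp_of_restr01_eq_zero {N l k : ℕ} (hl : l ≤ N) {f : ℝ → ℝ}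
    (hf : f ∈ Vsp (-(1 / 2 ^ (N + 1))) (1 - 1 / 2 ^ (N + 1)) l k) (h : restr01 f = 0) :
    f = 0 := by
  have hpos : (0 : ℝ) < 1 / 2 ^ (N + 1) := by positivity
  have hlt : (1 : ℝ) / 2 ^ (N + 1) < 1 / 2 ^ l :=
    one_div_lt_one_div_of_lt (by positivity) (pow_lt_pow_right₀ (by norm_num) (by omega))
  refine eq_zero_of_mem_Vsp_of_eqOn_Ico (c := 0) (by linarith) hf (by linarith) ?_ fun x hx => ?_
  · rw [show (1 : ℝ) - 1 / 2 ^ (N + 1) - -(1 / 2 ^ (N + 1)) = 1 by ring]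
    linarith
  · have hx' : x ∈ Set.Ico (0 : ℝ) 1 := ⟨hx.1, by linarith [hx.2]⟩
    exact (Set.indicator_of_mem hx' f).symm.trans (congrFun h x)

/-- Nodes `0, 1 - h_N / 2, 1` of the coarsest dual grid, continued past `1`. -/
noncomputable def dualNode (N j : ℕ) : ℝ :=
  if j = 0 then 0 else if j = 1 then 1 - 1 / 2 ^ (N + 1) else j - 1

lemma dualNode_strictMono (N : ℕ) : StrictMono (dualNode N) := by
  have hpos : (0 : ℝ) < 1 / 2 ^ (N + 1) := by positivity
  have hlt : (1 : ℝ) / 2 ^ (N + 1) < 1 := by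
    rw [div_lt_one (by positivity)]
    exact one_lt_pow₀ (by norm_num) (by omega)
  refine strictMono_nat_of_lt_succ fun j => ?_
  match j with
  | 0 => simp only [dualNode]; norm_num at *; linarith
  | 1 => simp only [dualNode]; norm_num at *
  | j + 2 => simp [dualNode]

lemma Vd_zero_eq_piecewisePoly (N k : ℕ) : Vd N 0 k = piecewisePoly (dualNode N) 2 k := by
  have : {f | dualPPoly N 0 k f} = (piecewisePoly (dualNode N) 2 k : Set (ℝ → ℝ)) := by
    ext f
    have h2 : dualNode N 2 = 1 := by norm_num [dualNode]
    have h0 : dualNode N 0 = 0 := by simp [dualNode]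
    rw [SetLike.mem_coe, mem_piecewisePoly, h2, h0]
    refine and_congr (forall_congr' fun j => ?_) Iff.rfl
    match j with
    | 0 => simp [dualLeft, dualRight, dualNode]
    | 1 => norm_num [dualLeft, dualRight, dualNode]
    | j + 2 => exact iff_of_true (fun h => absurd h (by simp)) (fun h => absurd h (by omega))
  rw [Vd, this, Submodule.span_eq]

/-- `dim W^k_{0,N,D} = 2(k+1)`, `dim W^k_{l,N,D} = 2^{l-1}(k+1)` for
`1 ≤ l ≤ N`; in particular the restriction map from `W_l^k([-h_N/2, 1-h_N/2])` to functions
on `[0,1]` is injective. -/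
theorem dual_increment_dimensions (N k : ℕ) (hN : 1 ≤ N) :
    Module.finrank ℝ (Wd N 0 k) = 2 * (k + 1) ∧
    ∀ l : ℕ, 1 ≤ l → l ≤ N →
      Module.finrank ℝ (Wd N l k) = 2 ^ (l - 1) * (k + 1) ∧
      Set.InjOn restr01
        ((Wsp (-(1 / 2 ^ (N + 1))) (1 - 1 / 2 ^ (N + 1)) l k : Submodule ℝ (ℝ → ℝ)) :
          Set (ℝ → ℝ)) := by
  refine ⟨?_, fun l hl hlN => ?_⟩
  · rw [Wd, if_pos rfl, Vd_zero_eq_piecewisePoly, finrank_piecewisePoly (dualNode_strictMono N)]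
  obtain ⟨n, rfl⟩ : ∃ n, l = n + 1 := ⟨l - 1, by omega⟩
  have hab : -(1 / 2 ^ (N + 1)) < (1 : ℝ) - 1 / 2 ^ (N + 1) := by linarith
  have hinj : Function.Injective (restr01.domRestrict
      (Wsp (-(1 / 2 ^ (N + 1))) (1 - 1 / 2 ^ (N + 1)) (n + 1) k)) := by
    rw [injective_iff_map_eq_zero]
    intro f hf
    exact Subtype.ext (eq_zero_of_mem_Vsp_of_restr01_eq_zero hlN
      (Wsp_succ_le_Vsp hab n k f.2) hf)
  refine ⟨?_, Set.injOn_iff_injective.2 hinj⟩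
  rw [Wd, if_neg n.succ_ne_zero, ← LinearMap.range_domRestrict,
    LinearMap.finrank_range_of_inj hinj, finrank_Wsp_succ hab, Nat.add_sub_cancel]
end

section
/- For every dimension d ≥ 2, polynomial degree k ≥ 0, and N ≥ 1, the dimension of the sparse dual finite element space Ṽ̂^k_{N,D} := ⊕_{l∈ℕ_0^d, |l|_1 ≤ N} (W^k_{l_1,N,D} ⊗ ⋯ ⊗ W^k_{l_d,N,D}) on [0,1]^d is bounded by C_d · 2^{d−1}(k+1)^d 2^N N^{d−1}, where C_d is a constant depending only on d. -/
open scoped BigOperators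
open MeasureTheory

/-- Pure tensor products `w_1(x_1)⋯w_d(x_d)` with `w_i ∈ S i`. -/
def tensorSet (d : ℕ) (S : Fin d → Submodule ℝ (ℝ → ℝ)) : Set ((Fin d → ℝ) → ℝ) :=
  {F | ∃ w : Fin d → ℝ → ℝ, (∀ i, w i ∈ S i) ∧ F = fun x => ∏ i, w i (x i)}

/-- The tensor product space `S 1 ⊗ ⋯ ⊗ S d`: the span of pure tensor products. -/
noncomputable def tensorSp (d : ℕ) (S : Fin d → Submodule ℝ (ℝ → ℝ)) :
    Submodule ℝ ((Fin d → ℝ) → ℝ) :=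
  Submodule.span ℝ (tensorSet d S)

/-- The sparse dual finite element space
`Ṽ̂^k_{N,D} = ⊕_{|l|_1 ≤ N} (W^k_{l_1,N,D} ⊗ ⋯ ⊗ W^k_{l_d,N,D})` on `[0,1]^d`. -/
noncomputable def sparseDualSp (d N k : ℕ) : Submodule ℝ ((Fin d → ℝ) → ℝ) :=
  ⨆ l : {l : Fin d → ℕ // ∑ i, l i ≤ N}, tensorSp d fun i => Wd N (l.1 i) k

/-- A function that vanishes off `[u 0, u m)` and is polynomial of degree at most `k` on each cell
`[u j, u (j + 1))` is a combination of the truncated monomials. -/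
theorem exists_finset_span_piecewise_polynomial (u : ℕ → ℝ) (hu : Monotone u) (m k : ℕ) :
    ∃ T : Finset (ℝ → ℝ), T.card ≤ m * (k + 1) ∧ ∀ f : ℝ → ℝ,
      (∀ j < m, ∃ p : Polynomial ℝ, p.natDegree ≤ k ∧
        ∀ x ∈ Set.Ico (u j) (u (j + 1)), f x = p.eval x) →
      (∀ x, x ∉ Set.Ico (u 0) (u m) → f x = 0) →
      f ∈ Submodule.span ℝ (T : Set (ℝ → ℝ)) := by
  classical
  let g : ℕ × ℕ → ℝ → ℝ := fun q => (Set.Ico (u q.1) (u (q.1 + 1))).indicator fun x => x ^ q.2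
  refine ⟨(Finset.range m ×ˢ Finset.range (k + 1)).image g,
    Finset.card_image_le.trans (by simp), fun f hf h0 => ?_⟩
  choose! p hp hfp using hf
  have key : f = ∑ j ∈ Finset.range m, ∑ i ∈ Finset.range (k + 1), (p j).coeff i • g (j, i) := by
    funext x
    simp only [Finset.sum_apply, Pi.smul_apply, smul_eq_mul, g]
    by_cases hx : ∃ j < m, x ∈ Set.Ico (u j) (u (j + 1))
    · obtain ⟨j, hj, hxj⟩ := hx
      rw [Finset.sum_eq_single_of_mem j (Finset.mem_range.2 hj)]
      · rw [hfp j hj x hxj, Polynomial.eval_eq_sum_range' (Nat.lt_succ_of_le (hp j hj))]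
        simp [Set.indicator_of_mem hxj]
      · intro i _ hij
        have hxi : x ∉ Set.Ico (u i) (u (i + 1)) := fun h =>
          Set.disjoint_left.1 (hu.pairwise_disjoint_on_Ico_succ hij) h hxj
        simp [Set.indicator_of_notMem hxi]
    · push Not at hx
      have hout : x ∉ Set.Ico (u 0) (u m) := by
        rintro ⟨h1, h2⟩
        have hle : ∀ j ≤ m, u j ≤ x := by
          intro j
          induction j with
          | zero => exact fun _ => h1
          | succ j ih =>
            intro hj
            by_contra! h
            exact hx j hj ⟨ih (by lia), h⟩
        exact absurd (hle m le_rfl) (not_le.2 h2)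
      rw [h0 x hout]
      refine (Finset.sum_eq_zero fun j hj => Finset.sum_eq_zero fun i _ => ?_).symm
      rw [Set.indicator_of_notMem (hx j (Finset.mem_range.1 hj)), mul_zero]
  rw [key]
  refine Submodule.sum_mem _ fun j hj => Submodule.sum_mem _ fun i hi =>
    Submodule.smul_mem _ _ (Submodule.subset_span ?_)
  exact Finset.mem_coe.2 (Finset.mem_image_of_mem g (Finset.mk_mem_product hj hi))

theorem exists_finset_Vsp_le_span {a b : ℝ} (hab : a ≤ b) (n k : ℕ) :
    ∃ T : Finset (ℝ → ℝ), T.card ≤ 2 ^ n * (k + 1) ∧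
      Vsp a b n k ≤ Submodule.span ℝ (T : Set (ℝ → ℝ)) := by
  have hmono : Monotone fun j : ℕ => a + j * ((b - a) / 2 ^ n) := by
    intro i j hij
    have h : (0 : ℝ) ≤ (b - a) / 2 ^ n := div_nonneg (sub_nonneg.2 hab) (by positivity)
    dsimp only
    gcongr
  obtain ⟨T, hT, h⟩ := exists_finset_span_piecewise_polynomial _ hmono (2 ^ n) k
  refine ⟨T, hT, Submodule.span_le.2 fun f hf => h f ?_ ?_⟩
  · intro j hj
    simpa using hf.1 j hj
  · intro x hx
    refine hf.2 x ?_
    have hb : a + ((2 ^ n : ℕ) : ℝ) * ((b - a) / 2 ^ n) = b := by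
      push_cast
      field_simp
      ring
    rw [hb] at hx
    simpa using hx

theorem exists_finset_Vd_zero_le_span (N k : ℕ) :
    ∃ T : Finset (ℝ → ℝ), T.card ≤ 2 * (k + 1) ∧
      Vd N 0 k ≤ Submodule.span ℝ (T : Set (ℝ → ℝ)) := by
  let u : ℕ → ℝ := fun j => if j = 0 then 0 else if j = 1 then 1 - 1 / 2 ^ (N + 1) else 1
  have hpos : (0 : ℝ) < 1 / 2 ^ (N + 1) := by positivity
  have hle : (1 : ℝ) / 2 ^ (N + 1) ≤ 1 :=
    (div_le_one (by positivity)).2 (one_le_pow₀ one_le_two)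
  have hmono : Monotone u := by
    refine monotone_nat_of_le_succ fun j => ?_
    match j with
    | 0 => simpa [u] using hle
    | 1 => simp [u]
    | j + 2 => simp [u]
  obtain ⟨T, hT, h⟩ := exists_finset_span_piecewise_polynomial u hmono 2 k
  refine ⟨T, hT, Submodule.span_le.2 fun f hf => h f ?_ ?_⟩
  · intro j hj
    have hj' := hf.1 j (by simpa using Nat.le_of_lt_succ hj)
    interval_cases j <;> simpa [u, dualLeft, dualRight] using hj'
  · intro x hx
    exact hf.2 x (by simpa [u] using hx)

theorem Wsp_le_Vsp (a b : ℝ) (n k : ℕ) : Wsp a b n k ≤ Vsp a b n k := by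
  unfold Wsp
  split_ifs with h
  · rw [h]
  · exact Submodule.span_le.2 fun f hf => hf.1

theorem exists_finset_Wd_le_span (N l k : ℕ) :
    ∃ T : Finset (ℝ → ℝ), T.card ≤ 2 ^ (l + 1) * (k + 1) ∧
      Wd N l k ≤ Submodule.span ℝ (T : Set (ℝ → ℝ)) := by
  classical
  unfold Wd
  split_ifs with hl
  · subst hl
    simpa using exists_finset_Vd_zero_le_span N k
  · obtain ⟨T, hT, h⟩ := exists_finset_Vsp_le_span
      (a := -(1 / 2 ^ (N + 1))) (b := 1 - 1 / 2 ^ (N + 1)) (by linarith) l k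
    refine ⟨T.image restr01, Finset.card_image_le.trans (hT.trans ?_), ?_⟩
    · gcongr <;> lia
    · rw [Finset.coe_image, ← Submodule.map_span]
      exact Submodule.map_mono ((Wsp_le_Vsp _ _ _ _).trans h)

theorem exists_finset_tensorSp_le_span {d : ℕ} {S : Fin d → Submodule ℝ (ℝ → ℝ)}
    {T : Fin d → Finset (ℝ → ℝ)}
    (hT : ∀ i, S i ≤ Submodule.span ℝ (T i : Set (ℝ → ℝ))) :
    ∃ U : Finset ((Fin d → ℝ) → ℝ), U.card ≤ ∏ i, (T i).card ∧
      tensorSp d S ≤ Submodule.span ℝ (U : Set ((Fin d → ℝ) → ℝ)) := by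
  classical
  let g : (Fin d → ℝ → ℝ) → (Fin d → ℝ) → ℝ := fun t x => ∏ i, t i (x i)
  refine ⟨(Fintype.piFinset T).image g,
    Finset.card_image_le.trans (Fintype.card_piFinset T).le, Submodule.span_le.2 ?_⟩
  rintro _ ⟨w, hw, rfl⟩
  have hc : ∀ i, ∃ c : (ℝ → ℝ) → ℝ, ∑ t ∈ T i, c t • t = w i := fun i => by
    obtain ⟨c, -, hc⟩ := Submodule.mem_span_finset.1 (hT i (hw i))
    exact ⟨c, hc⟩
  choose c hc using hc
  have key : (fun x : Fin d → ℝ => ∏ i, w i (x i)) =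
      ∑ t ∈ Fintype.piFinset T, (∏ i, c i (t i)) • g t := by
    funext x
    simp_rw [← hc, Finset.sum_apply, Pi.smul_apply, smul_eq_mul]
    rw [Finset.prod_univ_sum]
    simp only [g, Finset.prod_mul_distrib]
  rw [key]
  exact Submodule.sum_mem _ fun t ht =>
    Submodule.smul_mem _ _ (Submodule.subset_span (Finset.mem_coe.2 (Finset.mem_image_of_mem g ht)))

/-- Once the last `e` coordinates are fixed, the values `∑ i, l i ≤ N` are distinct, so the
corresponding powers of two sum to at most `2 ^ (N + 1)`. -/
theorem sum_two_pow_sum_le (e N : ℕ) :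
    ∑ l ∈ (Fintype.piFinset fun _ : Fin (e + 1) => Finset.range (N + 1)) with ∑ i, l i ≤ N,
      2 ^ (∑ i, l i) ≤ (N + 1) ^ e * 2 ^ (N + 1) := by
  classical
  rw [← Finset.sum_fiberwise_of_maps_to
    (t := Fintype.piFinset fun _ : Fin e => Finset.range (N + 1)) (g := Fin.tail)]
  · refine (Finset.sum_le_card_nsmul _ _ (2 ^ (N + 1)) fun t _ => ?_).trans (by simp)
    rw [← Finset.sum_image (f := fun n => 2 ^ n) (g := fun l : Fin (e + 1) → ℕ => ∑ i, l i)]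
    · refine (Nat.geomSum_lt le_rfl fun n hn => ?_).le
      simp only [Finset.mem_image, Finset.mem_filter] at hn
      obtain ⟨l, hl, rfl⟩ := hn
      exact Nat.lt_succ_of_le hl.1.2
    · intro l hl l' hl' h
      simp only [Finset.coe_filter, Set.mem_ofPred_eq] at hl hl'
      have htail : Fin.tail l = Fin.tail l' := hl.2.trans hl'.2.symm
      have hsum : ∑ i : Fin e, l i.succ = ∑ i : Fin e, l' i.succ :=
        Finset.sum_congr rfl fun i _ => congrFun htail i
      simp only [Fin.sum_univ_succ] at h
      have h0 : l 0 = l' 0 := by lia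
      rw [← Fin.cons_self_tail l, ← Fin.cons_self_tail l', htail, h0]
  · intro l hl
    simp only [Finset.mem_filter, Fintype.mem_piFinset] at hl ⊢
    exact fun i => hl.1 i.succ

/-- the dimension of the sparse dual space is bounded by
`C_d · 2^{d-1} (k+1)^d 2^N N^{d-1}` with `C_d` depending only on `d`. -/
theorem sparse_dual_dimension_bound (d : ℕ) (hd : 2 ≤ d) :
    ∃ C : ℕ, 0 < C ∧ ∀ k N : ℕ, 1 ≤ N →
      FiniteDimensional ℝ (sparseDualSp d N k) ∧
      Module.finrank ℝ (sparseDualSp d N k) ≤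
        C * (2 ^ (d - 1) * (k + 1) ^ d * 2 ^ N * N ^ (d - 1)) := by
  classical
  obtain ⟨e, rfl⟩ : ∃ e, d = e + 1 := ⟨d - 1, by lia⟩
  refine ⟨2 ^ (e + 2), by positivity, fun k N hN => ?_⟩
  choose T hT hspan using fun l => exists_finset_Wd_le_span N l k
  choose U hU hUspan using fun l : Fin (e + 1) → ℕ =>
    exists_finset_tensorSp_le_span fun i => hspan (l i)
  let I := {l ∈ Fintype.piFinset fun _ : Fin (e + 1) => Finset.range (N + 1) | ∑ i, l i ≤ N}
  have hle : sparseDualSp (e + 1) N k ≤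
      Submodule.span ℝ (I.biUnion U : Set ((Fin (e + 1) → ℝ) → ℝ)) := by
    refine iSup_le fun l => (hUspan l.1).trans (Submodule.span_mono ?_)
    refine Finset.coe_subset.2 (Finset.subset_biUnion_of_mem U ?_)
    simp only [I, Finset.mem_filter, Fintype.mem_piFinset, Finset.mem_range]
    exact ⟨fun i => Nat.lt_succ_of_le
      ((Finset.single_le_sum (fun _ _ => Nat.zero_le _) (Finset.mem_univ i)).trans l.2), l.2⟩
  have hcard (l : Fin (e + 1) → ℕ) :
      (U l).card ≤ 2 ^ (∑ i, l i) * (2 ^ (e + 1) * (k + 1) ^ (e + 1)) := by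
    refine (hU l).trans ((Finset.prod_le_prod' fun i _ => hT (l i)).trans (le_of_eq ?_))
    simp only [pow_succ 2 (l _), Finset.prod_mul_distrib, Finset.prod_pow_eq_pow_sum,
      Finset.prod_const, Finset.card_univ, Fintype.card_fin]
    ring
  refine ⟨Submodule.finiteDimensional_of_le hle, ?_⟩
  calc Module.finrank ℝ (sparseDualSp (e + 1) N k)
      ≤ Module.finrank ℝ (Submodule.span ℝ (I.biUnion U : Set ((Fin (e + 1) → ℝ) → ℝ))) :=
        Submodule.finrank_mono hle
    _ ≤ (I.biUnion U).card := finrank_span_finset_le_card _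
    _ ≤ ∑ l ∈ I, (U l).card := Finset.card_biUnion_le
    _ ≤ ∑ l ∈ I, 2 ^ (∑ i, l i) * (2 ^ (e + 1) * (k + 1) ^ (e + 1)) :=
        Finset.sum_le_sum fun l _ => hcard l
    _ = (∑ l ∈ I, 2 ^ (∑ i, l i)) * (2 ^ (e + 1) * (k + 1) ^ (e + 1)) := by
        rw [Finset.sum_mul]
    _ ≤ ((2 * N) ^ e * 2 ^ (N + 1)) * (2 ^ (e + 1) * (k + 1) ^ (e + 1)) := by
        refine Nat.mul_le_mul_right _ ((sum_two_pow_sum_le e N).trans ?_)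
        gcongr
        lia
    _ = 2 ^ (e + 2) * (2 ^ (e + 1 - 1) * (k + 1) ^ (e + 1) * 2 ^ N * N ^ (e + 1 - 1)) := by
        simp only [Nat.add_sub_cancel]
        ring
end

section
/- For every dimension d ≥ 2, polynomial degree k ≥ 0, and N ≥ 1, the dimension of the sparse finite element space V̂_N^k([0,1]^d) := ⊕_{l∈ℕ_0^d, |l|_1 ≤ N} W_l^k([0,1]^d) is bounded by C_d · (k+1)^d 2^N N^{d−1}, where C_d is a constant depending only on d. -/
open scoped BigOperators
open MeasureTheory

/-- The sparse finite element space `V̂_N^k([0,1]^d) = ⊕_{|l|_1 ≤ N} W_l^k([0,1]^d)`. -/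
noncomputable def sparseSp (d N k : ℕ) : Submodule ℝ ((Fin d → ℝ) → ℝ) :=
  ⨆ l : {l : Fin d → ℕ // ∑ i, l i ≤ N}, tensorSp d fun i => Wsp 0 1 (l.1 i) k

/-- The monomial `x ^ m` restricted to the `j`-th cell of the uniform `2 ^ n`-cell partition of
`[0, 1)`. -/
noncomputable def cellMonomial (n k : ℕ) (c : Fin (2 ^ n) × Fin (k + 1)) : ℝ → ℝ :=
  Set.indicator {x : ℝ | 0 ≤ x ∧ ⌊x * 2 ^ n⌋₊ = c.1} fun x => x ^ (c.2 : ℕ)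

theorem Vsp_le_span_cellMonomial (n k : ℕ) :
    Vsp 0 1 n k ≤ Submodule.span ℝ (Set.range (cellMonomial n k)) := by
  refine Submodule.span_le.2 ?_
  rintro f ⟨hcell, hout⟩
  choose p hdeg hp using fun j : Fin (2 ^ n) => hcell j j.2
  refine Submodule.mem_span_range_iff_exists_fun ℝ |>.2
    ⟨fun c => (p c.1).coeff c.2, funext fun x => ?_⟩
  have h2 : (0 : ℝ) < 2 ^ n := by positivity
  simp only [Finset.sum_apply, Pi.smul_apply, smul_eq_mul, cellMonomial, Set.indicator_apply,
    Set.mem_ofPred_eq, Fintype.sum_prod_type]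
  by_cases hx : x ∈ Set.Ico (0 : ℝ) 1
  · have hlt : ⌊x * 2 ^ n⌋₊ < 2 ^ n := by
      rw [Nat.floor_lt (mul_nonneg hx.1 h2.le)]
      push_cast
      nlinarith [hx.2]
    rw [Finset.sum_eq_single (⟨_, hlt⟩ : Fin (2 ^ n))]
    · rw [hp ⟨_, hlt⟩ x, Polynomial.eval_eq_sum_range' (Nat.lt_succ_of_le (hdeg _)),
        Finset.sum_range]
      · simp [hx.1]
      · have h₁ := Nat.floor_le (mul_nonneg hx.1 h2.le)
        have h₂ := Nat.lt_floor_add_one (x * 2 ^ n)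
        constructor
        · simpa [← div_eq_mul_inv, div_le_iff₀ h2] using h₁
        · simpa [← div_eq_mul_inv, lt_div_iff₀ h2] using h₂
    · intro j _ hj
      have : ⌊x * 2 ^ n⌋₊ ≠ j := fun h => hj (Fin.ext h.symm)
      simp [this]
    · simp
  · rw [hout x hx]
    refine Finset.sum_eq_zero fun j _ => Finset.sum_eq_zero fun m _ => ?_
    rw [if_neg, mul_zero]
    rintro ⟨h0, hj⟩
    refine hx ⟨h0, ?_⟩
    have h := (Nat.floor_lt (mul_nonneg h0 h2.le)).1 (hj ▸ j.2)
    push_cast at h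
    nlinarith

theorem tensorSp_le_span_prod {d : ℕ} {S : Fin d → Submodule ℝ (ℝ → ℝ)} {ι : Fin d → Type*}
    [∀ i, Fintype (ι i)] {b : ∀ i, ι i → ℝ → ℝ}
    (hS : ∀ i, S i ≤ Submodule.span ℝ (Set.range (b i))) :
    tensorSp d S ≤ Submodule.span ℝ
      (Set.range fun (c : ∀ i, ι i) (x : Fin d → ℝ) => ∏ i, b i (c i) (x i)) := by
  refine Submodule.span_le.2 ?_
  rintro F ⟨w, hw, rfl⟩
  choose a ha using fun i => Submodule.mem_span_range_iff_exists_fun ℝ |>.1 (hS i (hw i))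
  refine Submodule.mem_span_range_iff_exists_fun ℝ |>.2
    ⟨fun c => ∏ i, a i (c i), funext fun x => ?_⟩
  simp only [← ha, Finset.sum_apply, Pi.smul_apply, smul_eq_mul, Finset.prod_univ_sum,
    Fintype.piFinset_univ, Finset.prod_mul_distrib]

/-- The multi-indices `l` with `|l|_1 ≤ N`. -/
def simplexIndices (d N : ℕ) : Finset (Fin d → ℕ) :=
  {l ∈ Fintype.piFinset fun _ => Finset.range (N + 1) | ∑ i, l i ≤ N}

theorem mem_simplexIndices {d N : ℕ} {l : Fin d → ℕ} :
    l ∈ simplexIndices d N ↔ ∑ i, l i ≤ N := by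
  simp only [simplexIndices, Finset.mem_filter, Fintype.mem_piFinset, Finset.mem_range,
    and_iff_right_iff_imp]
  exact fun h i => Nat.lt_succ_of_le
    ((Finset.single_le_sum (fun _ _ => Nat.zero_le _) (Finset.mem_univ i)).trans h)

theorem sum_two_pow_simplexIndices_le (d N : ℕ) :
    ∑ l ∈ simplexIndices (d + 1) N, 2 ^ ∑ i, l i ≤ (N + 1) ^ d * 2 ^ (N + 1) := by
  have hmaps : ∀ l ∈ simplexIndices (d + 1) N,
      Fin.tail l ∈ Fintype.piFinset fun _ : Fin d => Finset.range (N + 1) := fun l hl =>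
    Fintype.mem_piFinset.2 fun i =>
      Fintype.mem_piFinset.1 (Finset.mem_filter.1 hl).1 i.succ
  rw [← Finset.sum_fiberwise_of_maps_to hmaps]
  refine (Finset.sum_le_card_nsmul _ _ (2 ^ (N + 1)) fun t _ => ?_).trans_eq (by simp)
  have hinj : Set.InjOn (fun l : Fin (d + 1) → ℕ => ∑ i, l i)
      ({l ∈ simplexIndices (d + 1) N | Fin.tail l = t} : Finset (Fin (d + 1) → ℕ)) := by
    intro l hl l' hl'
    simp only [Finset.coe_filter, Set.mem_ofPred_eq] at hl hl'
    intro h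
    simp only [Fin.sum_univ_succ] at h
    have htail : Fin.tail l = Fin.tail l' := hl.2.trans hl'.2.symm
    have hs : ∑ i : Fin d, l i.succ = ∑ i : Fin d, l' i.succ :=
      Finset.sum_congr rfl fun i _ => congrFun htail i
    have h0 : l 0 = l' 0 := by omega
    rw [← Fin.cons_self_tail l, ← Fin.cons_self_tail l', h0, htail]
  rw [← Finset.sum_image (f := fun s => 2 ^ s) hinj]
  calc _ ≤ ∑ s ∈ Finset.range (N + 1), 2 ^ s := by
        refine Finset.sum_le_sum_of_subset fun s hs => ?_
        obtain ⟨l, hl, rfl⟩ := Finset.mem_image.1 hs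
        exact Finset.mem_range.2
          (Nat.lt_succ_of_le (mem_simplexIndices.1 (Finset.mem_filter.1 hl).1))
    _ ≤ 2 ^ (N + 1) := (Nat.geomSum_lt le_rfl fun s hs => Finset.mem_range.1 hs).le

theorem sparseSp_le_span (d N k : ℕ) :
    sparseSp d N k ≤ Submodule.span ℝ (Set.range
      fun (c : Σ l : simplexIndices d N, ∀ i, Fin (2 ^ l.1 i) × Fin (k + 1)) (x : Fin d → ℝ) =>
        ∏ i, cellMonomial (c.1.1 i) k (c.2 i) (x i)) := by
  refine iSup_le fun l => (tensorSp_le_span_prod fun i =>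
    (Wsp_le_Vsp 0 1 (l.1 i) k).trans (Vsp_le_span_cellMonomial _ k)).trans
      (Submodule.span_mono ?_)
  rintro _ ⟨c, rfl⟩
  exact ⟨⟨⟨l.1, mem_simplexIndices.2 l.2⟩, c⟩, rfl⟩

theorem finiteDimensional_sparseSp_and_finrank_le_sum (d N k : ℕ) :
    FiniteDimensional ℝ (sparseSp d N k) ∧
    Module.finrank ℝ (sparseSp d N k) ≤
      (k + 1) ^ d * ∑ l ∈ simplexIndices d N, 2 ^ ∑ i, l i := by
  have := FiniteDimensional.span_of_finite ℝ (Set.finite_range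
    fun (c : Σ l : simplexIndices d N, ∀ i, Fin (2 ^ l.1 i) × Fin (k + 1)) (x : Fin d → ℝ) =>
      ∏ i, cellMonomial (c.1.1 i) k (c.2 i) (x i))
  refine ⟨Submodule.finiteDimensional_of_le (sparseSp_le_span d N k), ?_⟩
  refine (Submodule.finrank_mono (sparseSp_le_span d N k)).trans
    ((finrank_range_le_card _).trans_eq ?_)
  simp only [Fintype.card_sigma, Fintype.card_pi, Fintype.card_prod, Fintype.card_fin,
    Finset.prod_mul_distrib, Finset.prod_const, Finset.card_univ, Finset.prod_pow_eq_pow_sum]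
  rw [← Finset.sum_mul, Finset.sum_coe_sort _ fun l : Fin d → ℕ => 2 ^ ∑ i, l i, mul_comm]

/-- the dimension of the sparse space `V̂_N^k([0,1]^d)` is bounded by
`C_d · (k+1)^d 2^N N^{d-1}` with `C_d` depending only on `d`. -/
theorem sparse_space_dimension_bound (d : ℕ) (hd : 2 ≤ d) :
    ∃ C : ℕ, 0 < C ∧ ∀ k N : ℕ, 1 ≤ N →
      FiniteDimensional ℝ (sparseSp d N k) ∧
      Module.finrank ℝ (sparseSp d N k) ≤ C * ((k + 1) ^ d * 2 ^ N * N ^ (d - 1)) := by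
  obtain ⟨e, rfl⟩ : ∃ e, d = e + 1 := ⟨d - 1, by omega⟩
  refine ⟨2 ^ (e + 1), by positivity, fun k N hN =>
    ⟨(finiteDimensional_sparseSp_and_finrank_le_sum _ N k).1, ?_⟩⟩
  calc Module.finrank ℝ (sparseSp (e + 1) N k)
      ≤ (k + 1) ^ (e + 1) * ∑ l ∈ simplexIndices (e + 1) N, 2 ^ ∑ i, l i :=
        (finiteDimensional_sparseSp_and_finrank_le_sum _ _ _).2
    _ ≤ (k + 1) ^ (e + 1) * ((N + 1) ^ e * 2 ^ (N + 1)) := by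
        gcongr
        exact sum_two_pow_simplexIndices_le e N
    _ ≤ (k + 1) ^ (e + 1) * ((2 * N) ^ e * 2 ^ (N + 1)) := by
        gcongr
        omega
    _ = 2 ^ (e + 1) * ((k + 1) ^ (e + 1) * 2 ^ N * N ^ (e + 1 - 1)) := by
        rw [Nat.add_sub_cancel]
        ring
end
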